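/- For all real parameters α > 0 and β > 0 and every complex number z, the Mittag-Leffler series Σ_{k=0}^∞ z^k / Γ(αk + β) is absolutely convergent (i.e., the function k ↦ z^k / Γ(αk + β) is summable over ℕ), so the two-parameter Mittag-Leffler function E_{α,β}(z) = Σ_{k=0}^∞ z^k / Γ(αk + β) is well defined on all of ℂ. -/

import Mathlib

open MeasureTheory Set in
/-- Exponential lower bound for the Gamma function, from the tail `x > T` of Euler's integral. -/
theorem Real.exp_neg_mul_rpow_le_Gamma {T s : ℝ} (hT : 0 < T) (hs : 1 ≤ s) :
    Real.exp (-T) * T ^ (s - 1) ≤ Real.Gamma s := by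
  have hint := Real.GammaIntegral_convergent (zero_lt_one.trans_le hs)
  have hsub : Ioi T ⊆ Ioi 0 := Ioi_subset_Ioi hT.le
  rw [Real.Gamma_eq_integral (zero_lt_one.trans_le hs)]
  calc Real.exp (-T) * T ^ (s - 1)
      = ∫ x in Ioi T, Real.exp (-x) * T ^ (s - 1) := by
        rw [integral_mul_const, integral_exp_neg_Ioi]
    _ ≤ ∫ x in Ioi T, Real.exp (-x) * x ^ (s - 1) := by
        refine setIntegral_mono_on ((integrableOn_exp_neg_Ioi T).mul_const _)
          (hint.mono_set hsub) measurableSet_Ioi fun x hx => ?_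
        have hx' : T ≤ x := (mem_Ioi.mp hx).le
        have : 0 ≤ s - 1 := sub_nonneg.mpr hs
        gcongr
    _ ≤ ∫ x in Ioi 0, Real.exp (-x) * x ^ (s - 1) := by
        refine setIntegral_mono_set hint ?_ hsub.eventuallyLE
        filter_upwards [ae_restrict_mem measurableSet_Ioi] with x hx
        have hx' : 0 ≤ x := (mem_Ioi.mp hx).le
        simp only [Pi.zero_apply]
        positivity

/-- For all real parameters `α > 0`, `β > 0` and every complex `z`, the
Mittag-Leffler series `∑ zᵏ / Γ(αk + β)` is absolutely convergent (the
summand is summable over `ℕ`), so `E_{α,β}(z)` is well defined on `ℂ`. -/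
theorem mittagLeffler_summable (α β : ℝ) (hα : 0 < α) (hβ : 0 < β) (z : ℂ) :
    Summable (fun k : ℕ => z ^ k / (Real.Gamma (α * k + β) : ℂ)) := by
  set R : ℝ := ‖z‖ + 1
  have hR0 : 0 < R := by positivity
  set T : ℝ := R ^ α⁻¹
  have hT : 0 < T := by positivity
  have hTα : T ^ α = R := Real.rpow_inv_rpow hR0.le hα.ne'
  have hgeom : Summable fun k : ℕ => (Real.exp (-T) * T ^ (β - 1))⁻¹ * (‖z‖ / R) ^ k :=
    (summable_geometric_of_lt_one (by positivity)
      ((div_lt_one hR0).mpr (lt_add_one _))).mul_left _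
  have hlarge : ∀ᶠ k : ℕ in Filter.atTop, 1 ≤ α * k + β :=
    (Filter.tendsto_atTop_add_const_right _ β
      (tendsto_natCast_atTop_atTop.const_mul_atTop hα)).eventually_ge_atTop 1
  refine hgeom.of_norm_bounded_eventually_nat ?_
  filter_upwards [hlarge] with k hk
  have hpow : T ^ (α * k + β - 1) = R ^ k * T ^ (β - 1) := by
    rw [add_sub_assoc, Real.rpow_add hT, Real.rpow_mul hT.le, hTα, Real.rpow_natCast]
  have hbound := Real.exp_neg_mul_rpow_le_Gamma hT hk
  rw [norm_div, norm_pow, Complex.norm_of_nonneg (Real.Gamma_pos_of_pos (by linarith)).le]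
  calc ‖z‖ ^ k / Real.Gamma (α * k + β)
      ≤ ‖z‖ ^ k / (Real.exp (-T) * T ^ (α * k + β - 1)) := by gcongr
    _ = (Real.exp (-T) * T ^ (β - 1))⁻¹ * (‖z‖ / R) ^ k := by
        rw [hpow, div_pow]
        field_simp
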